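/- In the c-free Fock model, let η, η₀ ∈ ℓ²(J) be unit vectors and a a bounded operator on ℋ. Then: (1) for all n, p ≥ 0, A_{η,n} ∘ (A*_η)^p = A_{η,n−p} if n ≥ p, and A_{η,n} ∘ (A*_η)^p = 0 if n < p; (2) π(a) ∘ A_{η,n} = 0 for every n ≥ 0; (3) A_{η,n} ∘ A_{η₀,m} = 0 for all n, m ≥ 1; (4) P_Ω ∘ A_{η,n} = A_{η,n} for every n ≥ 0, and A_{η,n} ∘ P_Ω = 0 for every n ≥ 1; (5) P_Ω ∘ A*_η = 0, i.e. (Id_E − P_Ω) ∘ A*_η = A*_η. -/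

import Mathlib

noncomputable section
open scoped ComplexInnerProductSpace ENNReal
open PowerSeries

/-- The Hilbert space `E = ℋ ⊕ ℓ²(List J; ℋ)` of the c-free Fock model. -/
abbrev FockE (H : Type*) [NormedAddCommGroup H] [InnerProductSpace ℂ H]
    (J : Type*) : Type _ :=
  WithLp 2 (H × lp (fun _ : List J => H) 2)

section FockModel

variable {H : Type*} [NormedAddCommGroup H] [InnerProductSpace ℂ H]
variable {J : Type*} [DecidableEq J]

/-- The first (ℋ-)component of an element of `E`. -/
def efst (ζ : FockE H J) : H := (WithLp.equiv 2 _ ζ).1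

/-- The second component of an element of `E`, as an ℋ-valued function on words. -/
def esnd (ζ : FockE H J) (w : List J) : H :=
  ((WithLp.equiv 2 _ ζ).2 : ∀ _ : List J, H) w

/-- The distinguished unit vector `Ω = (0, δ_[]·ω)` of `E`. -/
def fockOmega (J : Type*) [DecidableEq J] {H : Type*} [NormedAddCommGroup H]
    [InnerProductSpace ℂ H] (ω : H) : FockE H J :=
  (WithLp.equiv 2 _).symm (0, lp.single 2 ([] : List J) ω)

/-- The unit vector `e_ω = (ω, 0)` of `E`. -/
def fockEOmega (J : Type*) [DecidableEq J] {H : Type*} [NormedAddCommGroup H]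
    [InnerProductSpace ℂ H] (ω : H) : FockE H J :=
  (WithLp.equiv 2 _).symm (ω, 0)

/-- The state `φ(T) = ⟨TΩ, Ω⟩` (inner product ℂ-linear in the first argument, i.e.
`⟪Ω, TΩ⟫` in Mathlib's convention). -/
def fockPhi (J : Type*) [DecidableEq J] {H : Type*} [NormedAddCommGroup H]
    [InnerProductSpace ℂ H] (ω : H) (T : FockE H J →L[ℂ] FockE H J) : ℂ :=
  ⟪fockOmega J ω, T (fockOmega J ω)⟫

/-- The state `ψ(T) = ⟨T e_ω, e_ω⟩`. -/
def fockPsi (J : Type*) [DecidableEq J] {H : Type*} [NormedAddCommGroup H]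
    [InnerProductSpace ℂ H] (ω : H) (T : FockE H J →L[ℂ] FockE H J) : ℂ :=
  ⟪fockEOmega J ω, T (fockEOmega J ω)⟫

/-- `P` is the orthogonal projection `P_Ω` onto `ℂΩ`. -/
def IsProjOmega (ω : H) (P : FockE H J →L[ℂ] FockE H J) : Prop :=
  ∀ ζ : FockE H J, P ζ = ⟪fockOmega J ω, ζ⟫ • fockOmega J ω

/-- `x` is the image `π(a)` of a bounded operator `a` on ℋ under the embedding `π`:
`π(a)(h, F) = (a h', w ↦ a (F' w))` where `(h', F') = (h, F) − ⟨(h,F), Ω⟩·Ω`. -/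
def IsEmbed (ω : H) (a : H →L[ℂ] H) (x : FockE H J →L[ℂ] FockE H J) : Prop :=
  ∀ ζ : FockE H J,
    efst (x ζ) = a (efst (ζ - ⟪fockOmega J ω, ζ⟫ • fockOmega J ω)) ∧
    ∀ w : List J,
      esnd (x ζ) w = a (esnd (ζ - ⟪fockOmega J ω, ζ⟫ • fockOmega J ω) w)

/-- `T` is the creation-type operator `A*_η`: `A*_η(h, F) = (0, G)` with `G [] = 0` and
`G (j :: w) = η j · ⟨F w, ω⟩ · ω`. -/
def IsCre (ω : H) (η : lp (fun _ : J => ℂ) 2) (T : FockE H J →L[ℂ] FockE H J) : Prop :=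
  ∀ ζ : FockE H J, efst (T ζ) = 0 ∧ esnd (T ζ) ([] : List J) = 0 ∧
    ∀ (j : J) (w : List J), esnd (T ζ) (j :: w) = η j • (⟪ω, esnd ζ w⟫ • ω)

/-- `ξ` is the vector `ξ_{η,n} = (0, F_n)`, where `F_n w = η(w₁)⋯η(w_n)·ω` on words of
length `n` and `F_n w = 0` otherwise.  (For `n = 0` this is exactly `Ω`.) -/
def IsXi (ω : H) (η : lp (fun _ : J => ℂ) 2) (n : ℕ) (ξ : FockE H J) : Prop :=
  efst ξ = 0 ∧ ∀ w : List J,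
    esnd ξ w = if w.length = n then (w.map fun j => η j).prod • ω else 0

/-- `T` is the annihilation-type operator `A_{η,n}`: the rank-one operator with
`T ξ_{η,n} = Ω` and `T ζ = 0` for `ζ ⊥ ξ_{η,n}`, i.e. `T ζ = ⟨ζ, ξ_{η,n}⟩·Ω`.
For `n = 0` this is exactly the projection `P_Ω`, as required. -/
def IsAnn (ω : H) (η : lp (fun _ : J => ℂ) 2) (n : ℕ)
    (T : FockE H J →L[ℂ] FockE H J) : Prop :=
  ∃ ξ : FockE H J, IsXi ω η n ξ ∧ ∀ ζ : FockE H J, T ζ = ⟪ξ, ζ⟫ • fockOmega J ω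

end FockModel

section FockHelpers

variable {H : Type*} [NormedAddCommGroup H] [InnerProductSpace ℂ H]
variable {J : Type*} [DecidableEq J]

lemma fock_ext {x y : FockE H J} (h1 : efst x = efst y) (h2 : ∀ w, esnd x w = esnd y w) :
    x = y := by
  apply (WithLp.equiv 2 _).injective
  refine Prod.ext h1 ?_
  apply lp.ext
  funext w
  exact h2 w

lemma fock_hasSum (x y : FockE H J) (hx : efst x = 0) :
    HasSum (fun w => ⟪esnd x w, esnd y w⟫) ⟪x, y⟫ := by
  have h := lp.hasSum_inner (𝕜 := ℂ) (WithLp.equiv 2 _ x).2 (WithLp.equiv 2 _ y).2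
  have e : ⟪x, y⟫ = ⟪(WithLp.equiv 2 _ x).2, (WithLp.equiv 2 _ y).2⟫ := by
    rw [WithLp.prod_inner_apply]
    have hx' : x.fst = 0 := hx
    change ⟪x.fst, y.fst⟫ + ⟪x.snd, y.snd⟫ = ⟪x.snd, y.snd⟫
    rw [hx', inner_zero_left, zero_add]
  rw [e]
  exact h

lemma efst_omega (ω : H) : efst (fockOmega J ω) = 0 := rfl

lemma esnd_omega (ω : H) (w : List J) :
    esnd (fockOmega J ω) w = if w = [] then ω else 0 := by
  change (lp.single 2 ([] : List J) ω : ∀ _ : List J, H) w = _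
  rw [lp.single_apply]
  split_ifs with h
  · subst h; simp
  · simp [h]

lemma isXi_omega (ω : H) (η : lp (fun _ : J => ℂ) 2) : IsXi ω η 0 (fockOmega J ω) := by
  refine ⟨rfl, fun w => ?_⟩
  rw [esnd_omega]
  cases w <;> simp

lemma omega_inner (ω : H) (ζ : FockE H J) : ⟪fockOmega J ω, ζ⟫ = ⟪ω, esnd ζ []⟫ := by
  have h := fock_hasSum (fockOmega J ω) ζ rfl
  refine h.unique ?_
  convert hasSum_single (f := fun w => ⟪esnd (fockOmega J ω) w, esnd ζ w⟫) [] ?_ using 1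
  · simp [esnd_omega]
  · intro w hw
    simp [esnd_omega, hw]

lemma xi_unique {ω : H} {η : lp (fun _ : J => ℂ) 2} {n : ℕ} {x y : FockE H J}
    (hx : IsXi ω η n x) (hy : IsXi ω η n y) : x = y :=
  fock_ext (hx.1.trans hy.1.symm) fun w => (hx.2 w).trans (hy.2 w).symm

lemma cre_xi {ω : H} (hω : ‖ω‖ = 1) {η : lp (fun _ : J => ℂ) 2}
    {C : FockE H J →L[ℂ] FockE H J} (hC : IsCre ω η C) {n : ℕ} {x : FockE H J}
    (hx : IsXi ω η n x) : IsXi ω η (n + 1) (C x) := by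
  refine ⟨(hC x).1, fun w => ?_⟩
  cases w with
  | nil => simp [(hC x).2.1]
  | cons j w =>
    rw [(hC x).2.2, hx.2]
    by_cases h : w.length = n
    · simp [h, inner_smul_right, hω, inner_self_eq_norm_sq_to_K, smul_smul]
    · simp [h]

lemma exists_xi {ω : H} (hω : ‖ω‖ = 1) {η : lp (fun _ : J => ℂ) 2}
    {C : FockE H J →L[ℂ] FockE H J} (hC : IsCre ω η C) (n : ℕ) :
    ∃ x, IsXi ω η n x := by
  induction n with
  | zero => exact ⟨_, isXi_omega ω η⟩
  | succ n ih => obtain ⟨x, hx⟩ := ih; exact ⟨_, cre_xi hω hC hx⟩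

lemma eta_hasSum {η : lp (fun _ : J => ℂ) 2} (hη : ‖η‖ = 1) :
    HasSum (fun j => ⟪η j, η j⟫) (1 : ℂ) := by
  have := lp.hasSum_inner (𝕜 := ℂ) η η
  rwa [inner_self_eq_norm_sq_to_K, hη, RCLike.ofReal_one, one_pow] at this

lemma hasSum_cons {f : J → ℂ} {g k : List J → ℂ} {s t : ℂ} (hf : HasSum f 1) (hg : HasSum g s)
    (hk : HasSum k t) (h0 : k [] = 0) (hc : ∀ j w, k (j :: w) = f j * g w) : t = s := by
  have h4 : HasSum (fun q : J × List J => f q.1 * g q.2) (1 * s) :=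
    hf.mul hg (summable_mul_of_summable_norm hf.summable.norm hg.summable.norm)
  rw [one_mul] at h4
  have hinj : Function.Injective (fun q : J × List J => q.1 :: q.2) := by
    rintro ⟨a, b⟩ ⟨c, d⟩ h
    simpa using h
  have h5 : HasSum (k ∘ fun q : J × List J => q.1 :: q.2) t := by
    rw [hinj.hasSum_iff]
    · exact hk
    · intro w hw
      cases w with
      | nil => exact h0
      | cons j w => exact absurd ⟨(j, w), rfl⟩ hw
  have e : (k ∘ fun q : J × List J => q.1 :: q.2) = fun q : J × List J => f q.1 * g q.2 :=
    funext fun q => hc q.1 q.2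
  rw [e] at h5
  exact h5.unique h4

lemma xi_inner_cre {ω : H} (hω : ‖ω‖ = 1) {η : lp (fun _ : J => ℂ) 2} (hη : ‖η‖ = 1)
    {C : FockE H J →L[ℂ] FockE H J} (hC : IsCre ω η C) {n : ℕ} {x y : FockE H J}
    (hx : IsXi ω η n x) (hy : IsXi ω η (n + 1) y) (ζ : FockE H J) :
    ⟪y, C ζ⟫ = ⟪x, ζ⟫ := by
  have h1 := fock_hasSum y (C ζ) hy.1
  have h2 := fock_hasSum x ζ hx.1
  refine hasSum_cons (eta_hasSum hη) h2 h1 ?_ ?_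
  · rw [(hC ζ).2.1, inner_zero_right]
  · intro j w
    rw [(hC ζ).2.2, hx.2, hy.2]
    by_cases h : w.length = n
    · have hoo : ⟪ω, ω⟫ = (1 : ℂ) := by simp [inner_self_eq_norm_sq_to_K, hω]
      rw [if_pos (by simp [h]), if_pos h, List.map_cons, List.prod_cons]
      rw [inner_smul_left, inner_smul_right, inner_smul_right, inner_smul_left, hoo, map_mul,
        RCLike.inner_apply]
      ring
    · rw [if_neg (by simpa using h), if_neg h, inner_zero_left, inner_zero_left, mul_zero]

lemma xi_inner_cre_pow {ω : H} (hω : ‖ω‖ = 1) {η : lp (fun _ : J => ℂ) 2} (hη : ‖η‖ = 1)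
    {C : FockE H J →L[ℂ] FockE H J} (hC : IsCre ω η C) {n : ℕ} {x : FockE H J}
    (hx : IsXi ω η n x) (ζ : FockE H J) (p : ℕ) : ∀ {y : FockE H J},
    IsXi ω η (n + p) y → ⟪y, (C ^ p) ζ⟫ = ⟪x, ζ⟫ := by
  induction p with
  | zero => intro y hy; rw [xi_unique hx hy]; simp
  | succ p ih =>
    intro y hy
    obtain ⟨z, hz⟩ := exists_xi hω hC (n + p)
    rw [pow_succ']
    change ⟪y, C ((C ^ p) ζ)⟫ = _
    rw [xi_inner_cre hω hη hC hz hy, ih hz]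

lemma omega_inner_cre {ω : H} {η : lp (fun _ : J => ℂ) 2}
    {C : FockE H J →L[ℂ] FockE H J} (hC : IsCre ω η C) (ζ : FockE H J) :
    ⟪fockOmega J ω, C ζ⟫ = 0 := by
  rw [omega_inner, (hC ζ).2.1, inner_zero_right]

lemma omega_inner_self {ω : H} (hω : ‖ω‖ = 1) :
    ⟪fockOmega J ω, fockOmega J ω⟫ = (1 : ℂ) := by
  rw [omega_inner, esnd_omega]
  simp [hω, inner_self_eq_norm_sq_to_K]

lemma xi_inner_omega {ω : H} {η : lp (fun _ : J => ℂ) 2} {n : ℕ} (hn : 1 ≤ n)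
    {x : FockE H J} (hx : IsXi ω η n x) : ⟪x, fockOmega J ω⟫ = (0 : ℂ) := by
  rw [← inner_conj_symm, omega_inner, hx.2, if_neg (by simp; omega)]
  simp

end FockHelpers

/-- Remark 1 of the paper: the basic algebraic relations between the operators
`A_{η,n}`, `A*_η`, `π(a)` and `P_Ω`. -/
theorem fock_operator_relations
    {H : Type*} [NormedAddCommGroup H] [InnerProductSpace ℂ H]
    {J : Type*} [DecidableEq J] (ω : H) (hω : ‖ω‖ = 1)
    (η η₀ : lp (fun _ : J => ℂ) 2) (hη : ‖η‖ = 1) (hη₀ : ‖η₀‖ = 1)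
    (a : H →L[ℂ] H)
    (C : FockE H J →L[ℂ] FockE H J) (hC : IsCre ω η C) :
    -- (1) `A_{η,n} (A*_η)^p = A_{η,n-p}` if `n ≥ p`, and `= 0` if `n < p`
    (∀ (n p : ℕ) (T T' : FockE H J →L[ℂ] FockE H J), IsAnn ω η n T → p ≤ n →
      IsAnn ω η (n - p) T' → T ∘L (C ^ p) = T') ∧
    (∀ (n p : ℕ) (T : FockE H J →L[ℂ] FockE H J), IsAnn ω η n T → n < p →
      T ∘L (C ^ p) = 0) ∧
    -- (2) `π(a) ∘ A_{η,n} = 0` for every `n ≥ 0`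
    (∀ (x : FockE H J →L[ℂ] FockE H J), IsEmbed ω a x →
      ∀ (n : ℕ) (T : FockE H J →L[ℂ] FockE H J), IsAnn ω η n T → x ∘L T = 0) ∧
    -- (3) `A_{η,n} ∘ A_{η₀,m} = 0` for all `n, m ≥ 1`
    (∀ (n m : ℕ) (T S : FockE H J →L[ℂ] FockE H J), 1 ≤ n → 1 ≤ m →
      IsAnn ω η n T → IsAnn ω η₀ m S → T ∘L S = 0) ∧
    -- (4) and (5): relations with the projection `P_Ω`
    (∀ (P : FockE H J →L[ℂ] FockE H J), IsProjOmega ω P →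
      (∀ (n : ℕ) (T : FockE H J →L[ℂ] FockE H J), IsAnn ω η n T → P ∘L T = T) ∧
      (∀ (n : ℕ) (T : FockE H J →L[ℂ] FockE H J), 1 ≤ n → IsAnn ω η n T →
        T ∘L P = 0) ∧
      P ∘L C = 0 ∧
      (ContinuousLinearMap.id ℂ (FockE H J) - P) ∘L C = C) := by
  refine ⟨?_, ?_, ?_, ?_, ?_⟩
  · rintro n p T T' ⟨y, hy, hT⟩ hp ⟨x, hx, hT'⟩
    ext1 ζ
    have hy' : IsXi ω η (n - p + p) y := by rwa [Nat.sub_add_cancel hp]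
    rw [ContinuousLinearMap.comp_apply, hT, hT', xi_inner_cre_pow hω hη hC hx ζ p hy']
  · rintro n p T ⟨y, hy, hT⟩ hp
    obtain ⟨q, rfl⟩ : ∃ q, p = n + (1 + q) := ⟨p - n - 1, by omega⟩
    ext1 ζ
    have hy' : IsXi ω η (0 + n) y := by rwa [zero_add]
    rw [ContinuousLinearMap.comp_apply, hT, pow_add, pow_add, pow_one]
    change ⟪y, (C ^ n) (C ((C ^ q) ζ))⟫ • _ = _
    rw [xi_inner_cre_pow hω hη hC (isXi_omega ω η) _ n hy', omega_inner_cre hC, zero_smul]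
    rfl
  · rintro x hx n T ⟨y, hy, hT⟩
    have hxO : x (fockOmega J ω) = 0 := by
      have h := hx (fockOmega J ω)
      rw [omega_inner_self hω, one_smul, sub_self] at h
      refine fock_ext (h.1.trans ?_) fun w => (h.2 w).trans ?_
      · exact map_zero a
      · exact map_zero a
    ext1 ζ
    rw [ContinuousLinearMap.comp_apply, hT, map_smul, hxO, smul_zero]
    rfl
  · rintro n m T S hn hm ⟨y, hy, hT⟩ ⟨z, hz, hS⟩
    ext1 ζ
    rw [ContinuousLinearMap.comp_apply, hS, map_smul, hT, xi_inner_omega hn hy, zero_smul,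
      smul_zero]
    rfl
  · intro P hP
    have hPC : P ∘L C = 0 := by
      ext1 ζ
      rw [ContinuousLinearMap.comp_apply, hP, omega_inner_cre hC, zero_smul]
      rfl
    refine ⟨?_, ?_, hPC, ?_⟩
    · rintro n T ⟨y, hy, hT⟩
      ext1 ζ
      rw [ContinuousLinearMap.comp_apply, hT, map_smul, hP, omega_inner_self hω, one_smul]
    · rintro n T hn ⟨y, hy, hT⟩
      ext1 ζ
      rw [ContinuousLinearMap.comp_apply, hP, map_smul, hT, xi_inner_omega hn hy, zero_smul,
        smul_zero]
      rfl
    · rw [ContinuousLinearMap.sub_comp, hPC, sub_zero, ContinuousLinearMap.id_comp]
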